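/- Consider a triple of generators (v_{ij}, v_{ji}, v_{kj}) of kQ̄_n with i, j, k pairwise distinct. Then the quasi-Poisson property {{v_{ij},v_{ji},v_{kj}}} = {{v_{ij},v_{ji},v_{kj}}}_qP holds if and only if the conditions in the applicable case below are all satisfied: (i) when i > j and k ≠ i, j: κ_a^{(i,j)}(μ^{(j)}_{ki} + α^{(j)}_{ki}) = 0 for all j < a < i; (1/2)(μ^{(j)}_{ki} + α^{(j)}_{ki}) − μ^{(j)}_{ki} α^{(j)}_{ki} = 1/4; ν^{(j)}_{ki}(μ^{(i)}_{kj} + 1/2) = 0; and μ^{(j)}_{ki} + α^{(j)}_{ki} − ν^{(j)}_{ki} ν^{(i)}_{kj} = 0. (ii) when k < i < j or i < j < k: κ_b^{(j,i)}(μ^{(j)}_{ki} − μ^{(j)}_{kb}) = 0, κ_b^{(j,i)}(α^{(j)}_{ki} − α^{(j)}_{kb}) = 0, and κ_b^{(j,i)} ν^{(j)}_{kb} = 0 for all i < b < j; (1/2)(μ^{(j)}_{ki} + α^{(j)}_{ki}) + μ^{(j)}_{ki} α^{(j)}_{ki} = −1/4; ν^{(j)}_{ki}(μ^{(i)}_{kj}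 − 1/2) = 0; and μ^{(j)}_{ki} + α^{(j)}_{ki} + ν^{(j)}_{ki} ν^{(i)}_{kj} = 0. (iii) when i < k < j: κ_b^{(j,i)}(μ^{(j)}_{ki} − μ^{(j)}_{kb} + (1/2)δ_{kb}) = 0 for all i < b < j; κ_b^{(j,i)}(α^{(j)}_{ki} − α^{(j)}_{kb} + (1/2)δ_{kb}) = 0 for all i < b ≤ k; κ_b^{(j,i)}(α^{(j)}_{ki} − α^{(j)}_{kb}) + κ_b^{(j,k)} κ_k^{(j,i)} = 0 for all k < b < j; κ_b^{(j,i)} ν^{(j)}_{kb} = 0 for all i < b < j; (1/2)(μ^{(j)}_{ki} + α^{(j)}_{ki}) + μ^{(j)}_{ki} α^{(j)}_{ki} = −1/4; ν^{(j)}_{ki}(μ^{(i)}_{kj} − 1/2) = 0; and μ^{(j)}_{ki} + α^{(j)}_{ki} + ν^{(j)}_{ki} ν^{(i)}_{kj} + κ_k^{(j,i)} = 0. -/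

import Mathlib

open TensorProduct

namespace NCQP

variable (𝕜 : Type) [Field 𝕜] [CharZero 𝕜]

/-- A double bracket on a `𝕜`-algebra `A`: a bilinear map `A × A → A ⊗ A` satisfying
cyclic antisymmetry and the Leibniz rule in its second argument (for the outer bimodule
structure on `A ⊗ A`). -/
structure DoubleBracket (A : Type) [Ring A] [Algebra 𝕜 A] where
  br : A →ₗ[𝕜] A →ₗ[𝕜] A ⊗[𝕜] A
  cyclic : ∀ a b : A, br b a = - (TensorProduct.comm 𝕜 A A) (br a b)
  leibniz : ∀ a b c : A,
    br a (b * c) = br a b * ((1 : A) ⊗ₜ[𝕜] c) + ((b : A) ⊗ₜ[𝕜] (1 : A)) * br a c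

variable {𝕜}
variable {A : Type} [Ring A] [Algebra 𝕜 A]

/-- The permutation `τ_(132)` on `A ⊗ A ⊗ A`, sending `a ⊗ b ⊗ c` to `b ⊗ c ⊗ a`. -/
noncomputable def tau132 (𝕜 : Type) [Field 𝕜] (A : Type) [Ring A] [Algebra 𝕜 A] :
    (A ⊗[𝕜] (A ⊗[𝕜] A)) ≃ₗ[𝕜] (A ⊗[𝕜] (A ⊗[𝕜] A)) :=
  (TensorProduct.comm 𝕜 A (A ⊗[𝕜] A)).trans (TensorProduct.assoc 𝕜 A A A)

/-- The permutation `τ_(123)` on `A ⊗ A ⊗ A`, sending `a ⊗ b ⊗ c` to `c ⊗ a ⊗ b`. -/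
noncomputable def tau123 (𝕜 : Type) [Field 𝕜] (A : Type) [Ring A] [Algebra 𝕜 A] :
    (A ⊗[𝕜] (A ⊗[𝕜] A)) ≃ₗ[𝕜] (A ⊗[𝕜] (A ⊗[𝕜] A)) :=
  (tau132 𝕜 A).trans (tau132 𝕜 A)

/-- Extension of a linear map `φ : A → A ⊗ A` to `A ⊗ A → A ⊗ A ⊗ A` acting on the
left factor: `b ⊗ c ↦ φ(b) ⊗ c`. -/
noncomputable def extL (𝕜 : Type) [Field 𝕜] (A : Type) [Ring A] [Algebra 𝕜 A]
    (φ : A →ₗ[𝕜] A ⊗[𝕜] A) : A ⊗[𝕜] A →ₗ[𝕜] A ⊗[𝕜] (A ⊗[𝕜] A) :=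
  (TensorProduct.assoc 𝕜 A A A).toLinearMap.comp (LinearMap.rTensor A φ)

/-- The triple bracket `{{a,b,c}}` associated with a double bracket. -/
noncomputable def tripleBr (D : DoubleBracket 𝕜 A) (a b c : A) : A ⊗[𝕜] (A ⊗[𝕜] A) :=
  extL 𝕜 A (D.br a) (D.br b c) + tau123 𝕜 A (extL 𝕜 A (D.br b) (D.br c a))
    + tau132 𝕜 A (extL 𝕜 A (D.br c) (D.br a b))

/-- The quasi-Poisson trivector term `{{a,b,c}}_qP` associated with a family of
orthogonal idempotents `e`. -/
noncomputable def tripleQP {I : Type} [Fintype I] (e : I → A) (a b c : A) :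
    A ⊗[𝕜] (A ⊗[𝕜] A) :=
  (4 : 𝕜)⁻¹ • ∑ s : I,
    ( (c * e s * a) ⊗ₜ[𝕜] ((e s * b) ⊗ₜ[𝕜] (e s))
    - (c * e s * a) ⊗ₜ[𝕜] ((e s) ⊗ₜ[𝕜] (b * e s))
    - (c * e s) ⊗ₜ[𝕜] ((a * e s * b) ⊗ₜ[𝕜] (e s))
    + (c * e s) ⊗ₜ[𝕜] ((a * e s) ⊗ₜ[𝕜] (b * e s))
    - (e s * a) ⊗ₜ[𝕜] ((e s * b) ⊗ₜ[𝕜] (e s * c))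
    + (e s * a) ⊗ₜ[𝕜] ((e s) ⊗ₜ[𝕜] (b * e s * c))
    + (e s) ⊗ₜ[𝕜] ((a * e s * b) ⊗ₜ[𝕜] (e s * c))
    - (e s) ⊗ₜ[𝕜] ((a * e s) ⊗ₜ[𝕜] (b * e s * c)) )

variable (𝕜)

/-- Generators of the path algebra of the quiver `Q̄_n`: one idempotent `E i` per vertex
and one arrow `V i j : j → i` for each ordered pair of distinct vertices. -/
inductive QGen (n : ℕ) : Type
  | E : Fin n → QGen n
  | V : Fin n → Fin n → QGen n

/-- The defining relations of the path algebra of `Q̄_n`. -/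
inductive QRel (n : ℕ) : FreeAlgebra 𝕜 (QGen n) → FreeAlgebra 𝕜 (QGen n) → Prop
  | orth (i j : Fin n) :
      QRel n (FreeAlgebra.ι 𝕜 (QGen.E i) * FreeAlgebra.ι 𝕜 (QGen.E j))
        (if i = j then FreeAlgebra.ι 𝕜 (QGen.E i) else 0)
  | sum_one :
      QRel n (∑ i : Fin n, FreeAlgebra.ι 𝕜 (QGen.E i)) 1
  | supp (i j : Fin n) :
      QRel n (FreeAlgebra.ι 𝕜 (QGen.V i j))
        (FreeAlgebra.ι 𝕜 (QGen.E i) * FreeAlgebra.ι 𝕜 (QGen.V i j) *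
          FreeAlgebra.ι 𝕜 (QGen.E j))
  | diag (i : Fin n) :
      QRel n (FreeAlgebra.ι 𝕜 (QGen.V i i)) 0

/-- The path algebra `𝕜 Q̄_n` of the double of an ordering of the complete `n`-partite
graph on `n` vertices. -/
abbrev PathAlg (n : ℕ) : Type := RingQuot (QRel 𝕜 n)

/-- The vertex idempotents `e i` of `𝕜 Q̄_n`. -/
noncomputable def pe (n : ℕ) (i : Fin n) : PathAlg 𝕜 n :=
  RingQuot.mkAlgHom 𝕜 (QRel 𝕜 n) (FreeAlgebra.ι 𝕜 (QGen.E i))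

/-- The arrows `v i j : j → i` of `𝕜 Q̄_n`. -/
noncomputable def pv (n : ℕ) (i j : Fin n) : PathAlg 𝕜 n :=
  RingQuot.mkAlgHom 𝕜 (QRel 𝕜 n) (FreeAlgebra.ι 𝕜 (QGen.V i j))

/-- The data of coefficient matrices `α, β, μ, ν` and scalars `κ`, together with a
`B`-linear double bracket on the path algebra `𝕜 Q̄_n` whose values on the generators
are given by the formulas (vv0)–(vvopp); `α s i j` stands for `α^{(s)}_{ij}` and
`κ i a j` stands for `κ_a^{(i,j)}`. -/
structure BracketData (n : ℕ) where
  α : Fin n → Fin n → Fin n → 𝕜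
  β : Fin n → Fin n → Fin n → 𝕜
  μ : Fin n → Fin n → Fin n → 𝕜
  ν : Fin n → Fin n → Fin n → 𝕜
  κ : Fin n → Fin n → Fin n → 𝕜
  D : DoubleBracket 𝕜 (PathAlg 𝕜 n)
  hα_skew : ∀ s i j, α s i j = - α s j i
  hα_row : ∀ s j, α s s j = 0
  hα_col : ∀ s j, α s j s = 0
  hβ_skew : ∀ s i j, β s i j = - β s j i
  hβ_row : ∀ s j, β s s j = 0
  hβ_col : ∀ s j, β s j s = 0
  hμ_diag : ∀ s i, μ s i i = 0
  hμ_row : ∀ s j, μ s s j = 0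
  hμ_col : ∀ s j, μ s j s = 0
  hν_diag : ∀ s i, ν s i i = 0
  hν_row : ∀ s j, ν s s j = 0
  hν_col : ∀ s j, ν s j s = 0
  hκ : ∀ i a j, ¬ (j < a ∧ a < i) → κ i a j = 0
  /-- the bracket vanishes on the idempotents, i.e. it is `B`-linear -/
  hB : ∀ s, D.br (pe 𝕜 n s) = 0
  hvv : ∀ i j, D.br (pv 𝕜 n i j) (pv 𝕜 n i j) = 0
  hdisj : ∀ i j p q, i ≠ p → i ≠ q → j ≠ p → j ≠ q →
    D.br (pv 𝕜 n i j) (pv 𝕜 n p q) = 0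
  hbr_α : ∀ i j l, i ≠ j → l ≠ j →
    D.br (pv 𝕜 n i j) (pv 𝕜 n l j) = α j i l • (pv 𝕜 n l j ⊗ₜ[𝕜] pv 𝕜 n i j)
  hbr_β : ∀ i j l, j ≠ i → l ≠ i →
    D.br (pv 𝕜 n i j) (pv 𝕜 n i l) = β i j l • (pv 𝕜 n i j ⊗ₜ[𝕜] pv 𝕜 n i l)
  hbr_μν : ∀ i j l, i ≠ j → l ≠ j → i ≠ l →
    D.br (pv 𝕜 n i j) (pv 𝕜 n j l) =
      μ j i l • (pe 𝕜 n j ⊗ₜ[𝕜] (pv 𝕜 n i j * pv 𝕜 n j l))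
      + ν j i l • (pe 𝕜 n j ⊗ₜ[𝕜] pv 𝕜 n i l)
  hbr_μν' : ∀ i j l, i ≠ j → l ≠ i → l ≠ j →
    D.br (pv 𝕜 n i j) (pv 𝕜 n l i) =
      - (μ i l j • ((pv 𝕜 n l i * pv 𝕜 n i j) ⊗ₜ[𝕜] pe 𝕜 n i))
      - ν i l j • (pv 𝕜 n l j ⊗ₜ[𝕜] pe 𝕜 n i)
  hbr_loop : ∀ i j, i ≠ j →
    D.br (pv 𝕜 n i j) (pv 𝕜 n j i) =
      (if j < i then (1 : 𝕜) else -1) •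
        ( pe 𝕜 n j ⊗ₜ[𝕜] pe 𝕜 n i
          + (2 : 𝕜)⁻¹ • ((pv 𝕜 n j i * pv 𝕜 n i j) ⊗ₜ[𝕜] pe 𝕜 n i)
          + (2 : 𝕜)⁻¹ • (pe 𝕜 n j ⊗ₜ[𝕜] (pv 𝕜 n i j * pv 𝕜 n j i)) )
      + ∑ a : Fin n, κ i a j • (pe 𝕜 n j ⊗ₜ[𝕜] (pv 𝕜 n i a * pv 𝕜 n a i))
      - ∑ b : Fin n, κ j b i • ((pv 𝕜 n j b * pv 𝕜 n b j) ⊗ₜ[𝕜] pe 𝕜 n i)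


set_option linter.unusedSectionVars false

section PathAlgebra

variable {𝕜} {n : ℕ}

lemma pe_mul_pe (i j : Fin n) : pe 𝕜 n i * pe 𝕜 n j = if i = j then pe 𝕜 n i else 0 := by
  have h := RingQuot.mkAlgHom_rel 𝕜 (QRel.orth (𝕜 := 𝕜) i j)
  rw [map_mul] at h
  refine h.trans ?_
  split_ifs
  · rfl
  · exact map_zero _

lemma pv_eq (i j : Fin n) : pv 𝕜 n i j = pe 𝕜 n i * pv 𝕜 n i j * pe 𝕜 n j := by
  have h := RingQuot.mkAlgHom_rel 𝕜 (QRel.supp (𝕜 := 𝕜) i j)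
  rwa [map_mul, map_mul] at h

lemma pe_mul_pv (s i j : Fin n) :
    pe 𝕜 n s * pv 𝕜 n i j = if s = i then pv 𝕜 n i j else 0 := by
  rw [pv_eq, ← mul_assoc, ← mul_assoc, pe_mul_pe]
  split_ifs with h
  · rw [h]
  · simp

lemma pv_mul_pe (i j s : Fin n) :
    pv 𝕜 n i j * pe 𝕜 n s = if j = s then pv 𝕜 n i j else 0 := by
  rw [pv_eq, mul_assoc, pe_mul_pe]
  split_ifs with h
  · rfl
  · simp

lemma pe_mul_pv_self (i j : Fin n) : pe 𝕜 n i * pv 𝕜 n i j = pv 𝕜 n i j := by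
  simp [pe_mul_pv]

lemma pv_mul_pe_self (i j : Fin n) : pv 𝕜 n i j * pe 𝕜 n j = pv 𝕜 n i j := by
  simp [pv_mul_pe]

lemma pv_mul_pv_of_ne {j p : Fin n} (h : j ≠ p) (i q : Fin n) :
    pv 𝕜 n i j * pv 𝕜 n p q = 0 := by
  rw [← pe_mul_pv_self p q, ← mul_assoc, pv_mul_pe, if_neg h, zero_mul]

/-- The representation of the path algebra over `𝕜[X]` with one-dimensional vertex spaces in
which the arrow `v i j` acts by `w i j * X`. -/
noncomputable def weightRep (w : Fin n → Fin n → 𝕜) :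
    PathAlg 𝕜 n →ₐ[𝕜] Matrix (Fin n) (Fin n) (Polynomial 𝕜) :=
  RingQuot.liftAlgHom 𝕜 ⟨FreeAlgebra.lift 𝕜 (fun g : QGen n => match g with
    | QGen.E i => Matrix.single i i 1
    | QGen.V i j => if i = j then 0 else Matrix.single i j (Polynomial.monomial 1 (w i j))), by
      intro x y h
      induction h with
      | orth i j =>
        by_cases h : i = j
        · subst h; simp
        · simp [h]
      | sum_one =>
        simp only [map_sum, FreeAlgebra.lift_ι_apply, map_one]
        ext i j : 1
        simp [Matrix.sum_apply, Matrix.single_apply, Matrix.one_apply, ite_and]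
      | supp i j =>
        by_cases h : i = j
        · simp [h]
        · simp [h]
      | diag i => simp⟩

lemma weightRep_pe (w : Fin n → Fin n → 𝕜) (i : Fin n) :
    weightRep w (pe 𝕜 n i) = Matrix.single i i 1 := by
  simp [weightRep, pe]

lemma weightRep_pv (w : Fin n → Fin n → 𝕜) {i j : Fin n} (h : i ≠ j) :
    weightRep w (pv 𝕜 n i j) = Matrix.single i j (Polynomial.monomial 1 (w i j)) := by
  simp [weightRep, pv, h]

lemma pv_self (i : Fin n) : pv 𝕜 n i i = 0 := by
  have h := RingQuot.mkAlgHom_rel 𝕜 (QRel.diag (𝕜 := 𝕜) i)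
  rwa [map_zero] at h

/-- The weighted count of paths of length `d` from `q` to `p` in an element of the path
algebra. -/
noncomputable def pathCoeff (w : Fin n → Fin n → 𝕜) (d : ℕ) (p q : Fin n) :
    PathAlg 𝕜 n →ₗ[𝕜] 𝕜 :=
  (Polynomial.lcoeff 𝕜 d) ∘ₗ (Matrix.entryLinearMap 𝕜 (Polynomial 𝕜) p q) ∘ₗ
    (weightRep w).toLinearMap

variable (w : Fin n → Fin n → 𝕜) (d : ℕ)

lemma pathCoeff_pe (p : Fin n) :
    pathCoeff w d p p (pe 𝕜 n p) = if d = 0 then 1 else 0 := by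
  simp [pathCoeff, weightRep_pe, Polynomial.coeff_one]

lemma pathCoeff_pv {p q : Fin n} (h : p ≠ q) :
    pathCoeff w d p q (pv 𝕜 n p q) = if d = 1 then w p q else 0 := by
  simp [pathCoeff, weightRep_pv w h, Polynomial.coeff_monomial, eq_comm]

lemma pathCoeff_pv_mul_pv (p b q : Fin n) :
    pathCoeff w d p q (pv 𝕜 n p b * pv 𝕜 n b q) =
      if p ≠ b ∧ b ≠ q ∧ d = 2 then w p b * w b q else 0 := by
  by_cases h : p = b
  · simp [h, pv_self]
  by_cases h' : b = q
  · simp [h', pv_self]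
  simp [pathCoeff, weightRep_pv w h, weightRep_pv w h', h, h', Polynomial.monomial_mul_monomial,
    Polynomial.coeff_monomial, eq_comm]

lemma pathCoeff_pv_mul_pv_mul_pv (p c b q : Fin n) :
    pathCoeff w d p q (pv 𝕜 n p c * (pv 𝕜 n c b * pv 𝕜 n b q)) =
      if p ≠ c ∧ c ≠ b ∧ b ≠ q ∧ d = 3 then w p c * (w c b * w b q) else 0 := by
  by_cases h : p = c
  · simp [h, pv_self]
  by_cases h' : c = b
  · simp [h', pv_self]
  by_cases h'' : b = q
  · simp [h'', pv_self]
  simp [pathCoeff, weightRep_pv w h, weightRep_pv w h', weightRep_pv w h'', h, h', h'',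
    Polynomial.monomial_mul_monomial, Polynomial.coeff_monomial, eq_comm]

end PathAlgebra

section Independence

variable {𝕜}

/-- The pure tensor `x ⊗ y ⊗ z`. -/
noncomputable def tripleTmul (𝕜 : Type) [Field 𝕜] {A : Type} [Ring A] [Algebra 𝕜 A]
    (x y z : A) : A ⊗[𝕜] (A ⊗[𝕜] A) :=
  x ⊗ₜ[𝕜] (y ⊗ₜ[𝕜] z)

/-- The functional `x ⊗ y ⊗ z ↦ f x * g y * h z` on a triple tensor product. -/
noncomputable def tripleFunctional (f g h : A →ₗ[𝕜] 𝕜) : A ⊗[𝕜] (A ⊗[𝕜] A) →ₗ[𝕜] 𝕜 :=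
  LinearMap.mul' 𝕜 𝕜 ∘ₗ TensorProduct.map f (LinearMap.mul' 𝕜 𝕜 ∘ₗ TensorProduct.map g h)

lemma tripleFunctional_tripleTmul (f g h : A →ₗ[𝕜] 𝕜) (x y z : A) :
    tripleFunctional f g h (tripleTmul 𝕜 x y z) = f x * (g y * h z) := by
  simp [tripleFunctional, tripleTmul]

variable {n : ℕ}

/-- Linear independence of the tensors of paths that occur in the triple bracket
`{{v i j, v j i, v m j}}`. -/
lemma path_tensors_independent {i j m : Fin n} (hjm : j ≠ m) {c : 𝕜} {P L R Q : Fin n → 𝕜}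
    (H : c • tripleTmul 𝕜 (pv 𝕜 n m j) (pe 𝕜 n i) (pe 𝕜 n j)
      + ∑ b, P b • tripleTmul 𝕜 (pv 𝕜 n m j * (pv 𝕜 n j b * pv 𝕜 n b j)) (pe 𝕜 n i) (pe 𝕜 n j)
      + ∑ b, Q b • tripleTmul 𝕜 (pv 𝕜 n m b * pv 𝕜 n b j) (pe 𝕜 n i) (pe 𝕜 n j)
      + ∑ a, L a • tripleTmul 𝕜 (pv 𝕜 n m j) (pv 𝕜 n i a * pv 𝕜 n a i) (pe 𝕜 n j)
      + ∑ b, R b • tripleTmul 𝕜 (pv 𝕜 n m j) (pe 𝕜 n i) (pv 𝕜 n j b * pv 𝕜 n b j) = 0) :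
    c = 0 ∧ (∀ b, b ≠ j → P b = 0) ∧ (∀ b, b ≠ m → b ≠ j → Q b = 0) ∧
      (∀ a, a ≠ i → L a = 0) ∧ (∀ b, b ≠ j → R b = 0) := by
  have key : ∀ (u v w : Fin n → Fin n → 𝕜) (d e f : ℕ), _ := fun u v w d e f =>
    congrArg (tripleFunctional (pathCoeff u d m j) (pathCoeff v e i i) (pathCoeff w f j j)) H
  simp only [map_add, map_sum, map_smul, map_zero, tripleFunctional_tripleTmul, pathCoeff_pe,
    pathCoeff_pv _ _ hjm.symm, pathCoeff_pv_mul_pv, pathCoeff_pv_mul_pv_mul_pv,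
    smul_eq_mul] at key
  refine ⟨?_, fun b hb => ?_, fun b hb hb' => ?_, fun a ha => ?_, fun b hb => ?_⟩
  · simpa using key 1 1 1 1 0 0
  · have h := key (fun p q => if p = j then if q = b then 1 else 0 else 1) 1 1 3 0 0
    simp [hjm.symm, hb.symm, ite_and] at h
    rw [Finset.sum_eq_single b (fun x _ hx => by simp [hx]) (by simp)] at h
    simpa [hjm.symm, hb, hb.symm, ite_and] using h
  · have h := key (fun p q => if p = m then if q = b then 1 else 0 else 1) 1 1 2 0 0
    simp [hjm.symm, ite_and] at h
    rw [Finset.sum_eq_single b (fun x _ hx => by simp [hx]) (by simp)] at h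
    simpa [hjm.symm, hb, hb.symm, hb', ite_and] using h
  · have h := key 1 (fun p q => if p = i then if q = a then 1 else 0 else 1) 1 1 2 0
    simp [ha.symm, ite_and] at h
    rw [Finset.sum_eq_single a (fun x _ hx => by simp [hx]) (by simp)] at h
    simpa [ha, ha.symm, ite_and] using h
  · have h := key 1 1 (fun p q => if p = j then if q = b then 1 else 0 else 1) 1 0 2
    simp [hb.symm, ite_and] at h
    rw [Finset.sum_eq_single b (fun x _ hx => by simp [hx]) (by simp)] at h
    simpa [hb, hb.symm, ite_and] using h

end Independence

section TripleBracket

variable {𝕜}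

/-- The linear map `p ⊗ q ↦ q ⊗ y ⊗ p`. -/
noncomputable def insertRev (𝕜 : Type) [Field 𝕜] {A : Type} [Ring A] [Algebra 𝕜 A] (y : A) :
    A ⊗[𝕜] A →ₗ[𝕜] A ⊗[𝕜] (A ⊗[𝕜] A) :=
  (tau132 𝕜 A).toLinearMap ∘ₗ (TensorProduct.assoc 𝕜 A A A).toLinearMap ∘ₗ
    (TensorProduct.mk 𝕜 (A ⊗[𝕜] A) A).flip y

lemma insertRev_tmul (x y z : A) : insertRev 𝕜 y (x ⊗ₜ[𝕜] z) = tripleTmul 𝕜 z y x := by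
  simp [insertRev, tau132, tripleTmul]

/-- The linear map `p ⊗ q ↦ y ⊗ p ⊗ q`. -/
noncomputable def insertLeft (𝕜 : Type) [Field 𝕜] {A : Type} [Ring A] [Algebra 𝕜 A] (y : A) :
    A ⊗[𝕜] A →ₗ[𝕜] A ⊗[𝕜] (A ⊗[𝕜] A) :=
  TensorProduct.mk 𝕜 A (A ⊗[𝕜] A) y

lemma insertLeft_tmul (x y z : A) : insertLeft 𝕜 y (x ⊗ₜ[𝕜] z) = tripleTmul 𝕜 y x z := rfl

/-- The linear map `p ⊗ q ↦ p ⊗ q ⊗ y`. -/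
noncomputable def insertRight (𝕜 : Type) [Field 𝕜] {A : Type} [Ring A] [Algebra 𝕜 A] (y : A) :
    A ⊗[𝕜] A →ₗ[𝕜] A ⊗[𝕜] (A ⊗[𝕜] A) :=
  (TensorProduct.assoc 𝕜 A A A).toLinearMap ∘ₗ (TensorProduct.mk 𝕜 (A ⊗[𝕜] A) A).flip y

lemma insertRight_tmul (x y z : A) : insertRight 𝕜 y (x ⊗ₜ[𝕜] z) = tripleTmul 𝕜 x z y := by
  simp [insertRight, tripleTmul]

lemma extL_tmul (φ : A →ₗ[𝕜] A ⊗[𝕜] A) (x y : A) :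
    extL 𝕜 A φ (x ⊗ₜ[𝕜] y) = insertRight 𝕜 y (φ x) := by
  simp [extL, insertRight]

lemma tau132_insertRight (y : A) (t : A ⊗[𝕜] A) :
    tau132 𝕜 A (insertRight 𝕜 y t) = insertRev 𝕜 y t := rfl

lemma tau123_insertRight (y : A) (t : A ⊗[𝕜] A) :
    tau123 𝕜 A (insertRight 𝕜 y t) = insertLeft 𝕜 y t := by
  induction t with
  | zero => simp
  | tmul p q => simp [insertRight, insertLeft, tau123, tau132]
  | add p q hp hq => rw [map_add, map_add, hp, hq, map_add]

variable {n : ℕ}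

lemma tripleQP_pv {i j m : Fin n} (hij : i ≠ j) (him : i ≠ m) (hjm : j ≠ m) :
    tripleQP (𝕜 := 𝕜) (pe 𝕜 n) (pv 𝕜 n i j) (pv 𝕜 n j i) (pv 𝕜 n m j) =
      -(4 : 𝕜)⁻¹ • tripleTmul 𝕜 (pv 𝕜 n m j) (pv 𝕜 n i j * pv 𝕜 n j i) (pe 𝕜 n j) := by
  rw [tripleQP, Finset.sum_eq_single j]
  · simp [pe_mul_pv, pv_mul_pe, pv_mul_pv_of_ne hij.symm, hij, hij.symm, hjm]
    exact (neg_smul _ _).symm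
  · intro s _ hs
    by_cases hi : s = i
    · subst hi
      simp [pe_mul_pv, pv_mul_pe, pv_mul_pv_of_ne him, hij.symm, him]
    · simp [pe_mul_pv, pv_mul_pe, hs.symm, hi]
  · simp

variable (S : BracketData 𝕜 n)

lemma BracketData.kappa_smul_br_cycle {i j m : Fin n} (hjm : j ≠ m) (b : Fin n) :
    S.κ j b i • S.D.br (pv 𝕜 n m j) (pv 𝕜 n j b * pv 𝕜 n b j) =
      (S.κ j b i * (S.μ j m b - 2⁻¹ * if m = b then 1 else 0)) •
          (pe 𝕜 n j ⊗ₜ[𝕜] (pv 𝕜 n m j * (pv 𝕜 n j b * pv 𝕜 n b j)))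
        + (S.κ j b i * S.ν j m b) • (pe 𝕜 n j ⊗ₜ[𝕜] (pv 𝕜 n m b * pv 𝕜 n b j))
        + (S.κ j b i * (S.α j m b - 2⁻¹ * if m = b then 1 else 0)) •
          ((pv 𝕜 n j b * pv 𝕜 n b j) ⊗ₜ[𝕜] pv 𝕜 n m j)
        - if m = b then S.κ j m i • (pe 𝕜 n j ⊗ₜ[𝕜] pv 𝕜 n m j
            + ∑ c, S.κ j c m • ((pv 𝕜 n j c * pv 𝕜 n c j) ⊗ₜ[𝕜] pv 𝕜 n m j)) else 0 := by
  by_cases hκ : S.κ j b i = 0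
  · simp only [hκ, zero_smul, zero_mul, add_zero]
    split_ifs with h
    · subst h; simp [hκ]
    · simp
  have hb : i < b ∧ b < j := by
    by_contra h
    exact hκ (S.hκ _ _ _ h)
  rw [S.D.leibniz, S.hbr_α m j b hjm.symm hb.2.ne]
  by_cases h : m = b
  · subst h
    have hz : ∀ a, S.κ m a j = 0 := fun a => S.hκ _ _ _ fun h => by omega
    rw [S.hbr_loop m j hjm.symm]
    simp only [hb.2.not_gt, if_false, if_true, hz, S.hμ_diag, S.hν_diag, zero_smul,
      Finset.sum_const_zero, add_mul, sub_mul, Finset.sum_mul, smul_mul_assoc, mul_smul_comm,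
      Algebra.TensorProduct.tmul_mul_tmul, mul_one, one_mul, pe_mul_pv_self, mul_assoc,
      add_zero]
    module
  · rw [S.hbr_μν m j b hjm.symm hb.2.ne h]
    simp only [h, if_false, add_mul, smul_mul_assoc, mul_smul_comm,
      Algebra.TensorProduct.tmul_mul_tmul, mul_one, one_mul, mul_assoc]
    module

lemma BracketData.extL_br_br_mu {i j m : Fin n} (hij : i ≠ j) (him : i ≠ m) (hjm : j ≠ m) :
    extL 𝕜 (PathAlg 𝕜 n) (S.D.br (pv 𝕜 n i j)) (S.D.br (pv 𝕜 n j i) (pv 𝕜 n m j)) =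
      (S.ν j m i * S.ν i m j - S.μ j m i * (if j < i then 1 else -1)) •
          tripleTmul 𝕜 (pv 𝕜 n m j) (pe 𝕜 n i) (pe 𝕜 n j)
        + (S.μ j m i * S.α j m i - 2⁻¹ * S.μ j m i * (if j < i then 1 else -1)) •
          tripleTmul 𝕜 (pv 𝕜 n m j) (pv 𝕜 n i j * pv 𝕜 n j i) (pe 𝕜 n j)
        - (2⁻¹ * S.μ j m i * (if j < i then 1 else -1)) •
          tripleTmul 𝕜 (pv 𝕜 n m j * (pv 𝕜 n j i * pv 𝕜 n i j)) (pe 𝕜 n i) (pe 𝕜 n j)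
        + (S.ν j m i * S.μ i m j) •
          tripleTmul 𝕜 (pv 𝕜 n m i * pv 𝕜 n i j) (pe 𝕜 n i) (pe 𝕜 n j)
        - S.μ j m i • ∑ a, S.κ i a j •
          tripleTmul 𝕜 (pv 𝕜 n m j) (pv 𝕜 n i a * pv 𝕜 n a i) (pe 𝕜 n j)
        + S.μ j m i • ∑ b, S.κ j b i •
          tripleTmul 𝕜 (pv 𝕜 n m j * (pv 𝕜 n j b * pv 𝕜 n b j)) (pe 𝕜 n i) (pe 𝕜 n j) := by
  rw [S.hbr_μν' j i m hij.symm hjm.symm him.symm]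
  simp only [map_sub, map_neg, map_smul, extL_tmul]
  rw [S.D.leibniz, S.hbr_α i j m hij hjm.symm, S.hbr_loop i j hij,
    S.hbr_μν' i j m hij him.symm hjm.symm, S.hα_skew j i m]
  simp only [mul_add, mul_sub, Finset.mul_sum, smul_mul_assoc, mul_smul_comm,
    Algebra.TensorProduct.tmul_mul_tmul, mul_one, one_mul, pv_mul_pe_self, map_add, map_sub,
    map_neg, map_smul, map_sum, insertRight_tmul, smul_add, smul_sub, smul_neg]
  module

lemma BracketData.tau123_extL_br_br {i j m : Fin n} (hij : i ≠ j) (hjm : j ≠ m) :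
    tau123 𝕜 (PathAlg 𝕜 n)
        (extL 𝕜 (PathAlg 𝕜 n) (S.D.br (pv 𝕜 n j i)) (S.D.br (pv 𝕜 n m j) (pv 𝕜 n i j))) =
      -(S.α j m i * (if j < i then 1 else -1)) •
          tripleTmul 𝕜 (pv 𝕜 n m j) (pe 𝕜 n i) (pe 𝕜 n j)
        - (2⁻¹ * S.α j m i * (if j < i then 1 else -1)) •
          tripleTmul 𝕜 (pv 𝕜 n m j) (pv 𝕜 n i j * pv 𝕜 n j i) (pe 𝕜 n j)
        - (2⁻¹ * S.α j m i * (if j < i then 1 else -1)) •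
          tripleTmul 𝕜 (pv 𝕜 n m j) (pe 𝕜 n i) (pv 𝕜 n j i * pv 𝕜 n i j)
        + S.α j m i • ∑ b, S.κ j b i •
          tripleTmul 𝕜 (pv 𝕜 n m j) (pe 𝕜 n i) (pv 𝕜 n j b * pv 𝕜 n b j)
        - S.α j m i • ∑ a, S.κ i a j •
          tripleTmul 𝕜 (pv 𝕜 n m j) (pv 𝕜 n i a * pv 𝕜 n a i) (pe 𝕜 n j) := by
  have hsgn : (if i < j then (1 : 𝕜) else -1) = -(if j < i then 1 else -1) := by
    rcases lt_or_gt_of_ne hij with h | h <;> simp [h, h.not_gt]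
  rw [S.hbr_α m j i hjm.symm hij]
  simp only [map_smul, extL_tmul, tau123_insertRight]
  rw [S.hbr_loop j i hij.symm, hsgn]
  simp only [map_add, map_sub, map_smul, map_sum, insertLeft_tmul, smul_add, smul_sub]
  module

lemma BracketData.tau132_extL_br_br {i j m : Fin n} (hij : i ≠ j) (him : i ≠ m) (hjm : j ≠ m) :
    tau132 𝕜 (PathAlg 𝕜 n)
        (extL 𝕜 (PathAlg 𝕜 n) (S.D.br (pv 𝕜 n m j)) (S.D.br (pv 𝕜 n i j) (pv 𝕜 n j i))) =
      (2⁻¹ * S.μ j m i * (if j < i then 1 else -1)) •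
          tripleTmul 𝕜 (pv 𝕜 n m j * (pv 𝕜 n j i * pv 𝕜 n i j)) (pe 𝕜 n i) (pe 𝕜 n j)
        + (2⁻¹ * S.ν j m i * (if j < i then 1 else -1)) •
          tripleTmul 𝕜 (pv 𝕜 n m i * pv 𝕜 n i j) (pe 𝕜 n i) (pe 𝕜 n j)
        + (2⁻¹ * S.α j m i * (if j < i then 1 else -1)) •
          tripleTmul 𝕜 (pv 𝕜 n m j) (pe 𝕜 n i) (pv 𝕜 n j i * pv 𝕜 n i j)
        + S.κ j m i • tripleTmul 𝕜 (pv 𝕜 n m j) (pe 𝕜 n i) (pe 𝕜 n j)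
        - ∑ b, (S.κ j b i * (S.μ j m b - 2⁻¹ * if m = b then 1 else 0)) •
          tripleTmul 𝕜 (pv 𝕜 n m j * (pv 𝕜 n j b * pv 𝕜 n b j)) (pe 𝕜 n i) (pe 𝕜 n j)
        - ∑ b, (S.κ j b i * S.ν j m b) •
          tripleTmul 𝕜 (pv 𝕜 n m b * pv 𝕜 n b j) (pe 𝕜 n i) (pe 𝕜 n j)
        - ∑ b, (S.κ j b i * (S.α j m b - 2⁻¹ * if m = b then 1 else 0)
            - S.κ j m i * S.κ j b m) •
          tripleTmul 𝕜 (pv 𝕜 n m j) (pe 𝕜 n i) (pv 𝕜 n j b * pv 𝕜 n b j) := by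
  rw [S.hbr_loop i j hij]
  have he : ∀ s, S.D.br (pv 𝕜 n m j) (pe 𝕜 n s) = 0 := fun s => by
    rw [S.D.cyclic, S.hB]; simp
  simp only [map_add, map_sub, map_smul, map_sum, extL_tmul, tau132_insertRight, he, map_zero,
    smul_zero, Finset.sum_const_zero, zero_add, add_zero]
  simp only [← map_smul (insertRev 𝕜 (pe 𝕜 n i)), S.kappa_smul_br_cycle hjm]
  rw [S.D.leibniz, S.hbr_μν m j i hjm.symm hij him.symm, S.hbr_α m j i hjm.symm hij]
  simp only [add_mul, smul_mul_assoc, mul_smul_comm, Algebra.TensorProduct.tmul_mul_tmul,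
    mul_one, one_mul, mul_assoc, map_add, map_sub, map_smul, map_sum, insertRev_tmul,
    apply_ite (insertRev 𝕜 (pe 𝕜 n i)), map_zero, Finset.sum_add_distrib,
    Finset.sum_sub_distrib, Finset.sum_ite_eq, Finset.mem_univ, if_true, smul_add]
  have hsum : ∀ (f : Fin n → 𝕜) (t : Fin n → PathAlg 𝕜 n ⊗[𝕜] (PathAlg 𝕜 n ⊗[𝕜] PathAlg 𝕜 n)),
      ∑ b, (f b - S.κ j m i * S.κ j b m) • t b
        = ∑ b, f b • t b + (-S.κ j m i) • ∑ b, S.κ j b m • t b := fun f t => by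
    rw [Finset.smul_sum, ← Finset.sum_add_distrib]
    exact Finset.sum_congr rfl fun b _ => by module
  have hneg : ∀ t : PathAlg 𝕜 n ⊗[𝕜] (PathAlg 𝕜 n ⊗[𝕜] PathAlg 𝕜 n), -t = (-1 : 𝕜) • t :=
    fun t => (neg_one_smul 𝕜 t).symm
  simp only [hsum]
  simp only [sub_eq_add_neg, hneg]
  module

lemma BracketData.tripleBr_sub_tripleQP {i j m : Fin n}
    (hij : i ≠ j) (him : i ≠ m) (hjm : j ≠ m) :
    tripleBr S.D (pv 𝕜 n i j) (pv 𝕜 n j i) (pv 𝕜 n m j)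
        - tripleQP (pe 𝕜 n) (pv 𝕜 n i j) (pv 𝕜 n j i) (pv 𝕜 n m j) =
      (S.κ j m i + S.ν j m i * S.ν i m j
          - (if j < i then 1 else -1) * (S.μ j m i + S.α j m i)) •
          tripleTmul 𝕜 (pv 𝕜 n m j) (pe 𝕜 n i) (pe 𝕜 n j)
        + ∑ b, (S.κ j b i * (S.μ j m i - S.μ j m b + 2⁻¹ * if m = b then 1 else 0)) •
          tripleTmul 𝕜 (pv 𝕜 n m j * (pv 𝕜 n j b * pv 𝕜 n b j)) (pe 𝕜 n i) (pe 𝕜 n j)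
        + ∑ b, (-(S.κ j b i * S.ν j m b) + if i = b then
              S.ν j m i * (S.μ i m j + 2⁻¹ * if j < i then 1 else -1) else 0) •
          tripleTmul 𝕜 (pv 𝕜 n m b * pv 𝕜 n b j) (pe 𝕜 n i) (pe 𝕜 n j)
        + ∑ a, (-(S.κ i a j * (S.μ j m i + S.α j m i)) + if j = a then
              S.μ j m i * S.α j m i + 4⁻¹
                - 2⁻¹ * (if j < i then 1 else -1) * (S.μ j m i + S.α j m i) else 0) •
          tripleTmul 𝕜 (pv 𝕜 n m j) (pv 𝕜 n i a * pv 𝕜 n a i) (pe 𝕜 n j)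
        + ∑ b, (S.κ j b i * (S.α j m i - S.α j m b + 2⁻¹ * if m = b then 1 else 0)
              + S.κ j m i * S.κ j b m) •
          tripleTmul 𝕜 (pv 𝕜 n m j) (pe 𝕜 n i) (pv 𝕜 n j b * pv 𝕜 n b j) := by
  rw [tripleBr, S.extL_br_br_mu hij him hjm, S.tau123_extL_br_br hij hjm,
    S.tau132_extL_br_br hij him hjm, tripleQP_pv hij him hjm]
  have hP : ∀ (x : 𝕜) (f g : Fin n → 𝕜)
      (t : Fin n → PathAlg 𝕜 n ⊗[𝕜] (PathAlg 𝕜 n ⊗[𝕜] PathAlg 𝕜 n)),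
      ∑ b, (S.κ j b i * (x - f b + g b)) • t b
        = x • ∑ b, S.κ j b i • t b + (-1 : 𝕜) • ∑ b, (S.κ j b i * (f b - g b)) • t b :=
    fun x f g t => by
      rw [Finset.smul_sum, Finset.smul_sum, ← Finset.sum_add_distrib]
      exact Finset.sum_congr rfl fun b _ => by module
  have hR : ∀ (x : 𝕜) (f g : Fin n → 𝕜)
      (t : Fin n → PathAlg 𝕜 n ⊗[𝕜] (PathAlg 𝕜 n ⊗[𝕜] PathAlg 𝕜 n)),
      ∑ b, (S.κ j b i * (x - f b + g b) + S.κ j m i * S.κ j b m) • t b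
        = x • ∑ b, S.κ j b i • t b
          + (-1 : 𝕜) • ∑ b, (S.κ j b i * (f b - g b) - S.κ j m i * S.κ j b m) • t b :=
    fun x f g t => by
      rw [Finset.smul_sum, Finset.smul_sum, ← Finset.sum_add_distrib]
      exact Finset.sum_congr rfl fun b _ => by module
  have hQ : ∀ (s : Fin n) (y : 𝕜) (f : Fin n → 𝕜)
      (t : Fin n → PathAlg 𝕜 n ⊗[𝕜] (PathAlg 𝕜 n ⊗[𝕜] PathAlg 𝕜 n)),
      ∑ b, (-f b + if s = b then y else 0) • t b = (-1 : 𝕜) • ∑ b, f b • t b + y • t s :=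
    fun s y f t => by
      simp only [add_smul, ite_smul, zero_smul, Finset.sum_add_distrib, Finset.sum_ite_eq,
        Finset.mem_univ, if_true, Finset.smul_sum, smul_smul, neg_one_mul]
  have hL : ∀ (x : 𝕜) (t : Fin n → PathAlg 𝕜 n ⊗[𝕜] (PathAlg 𝕜 n ⊗[𝕜] PathAlg 𝕜 n)),
      ∑ a, (S.κ i a j * x) • t a = x • ∑ a, S.κ i a j • t a :=
    fun x t => by
      rw [Finset.smul_sum]
      exact Finset.sum_congr rfl fun b _ => by module
  have hneg : ∀ t : PathAlg 𝕜 n ⊗[𝕜] (PathAlg 𝕜 n ⊗[𝕜] PathAlg 𝕜 n), -t = (-1 : 𝕜) • t :=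
    fun t => (neg_one_smul 𝕜 t).symm
  rw [hP, hR, hQ, hQ, hL]
  simp only [sub_eq_add_neg (G := PathAlg 𝕜 n ⊗[𝕜] (PathAlg 𝕜 n ⊗[𝕜] PathAlg 𝕜 n)), hneg]
  module

lemma BracketData.tripleBr_eq_tripleQP_iff {i j m : Fin n}
    (hij : i ≠ j) (him : i ≠ m) (hjm : j ≠ m) :
    tripleBr S.D (pv 𝕜 n i j) (pv 𝕜 n j i) (pv 𝕜 n m j)
        = tripleQP (pe 𝕜 n) (pv 𝕜 n i j) (pv 𝕜 n j i) (pv 𝕜 n m j) ↔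
      S.κ j m i + S.ν j m i * S.ν i m j
          - (if j < i then 1 else -1) * (S.μ j m i + S.α j m i) = 0 ∧
      (∀ b, b ≠ j → S.κ j b i * (S.μ j m i - S.μ j m b + 2⁻¹ * if m = b then 1 else 0) = 0) ∧
      (∀ b, b ≠ m → b ≠ j → -(S.κ j b i * S.ν j m b) + (if i = b then
        S.ν j m i * (S.μ i m j + 2⁻¹ * if j < i then 1 else -1) else 0) = 0) ∧
      (∀ a, a ≠ i → -(S.κ i a j * (S.μ j m i + S.α j m i)) + (if j = a then
        S.μ j m i * S.α j m i + 4⁻¹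
          - 2⁻¹ * (if j < i then 1 else -1) * (S.μ j m i + S.α j m i) else 0) = 0) ∧
      (∀ b, b ≠ j → S.κ j b i * (S.α j m i - S.α j m b + 2⁻¹ * if m = b then 1 else 0)
        + S.κ j m i * S.κ j b m = 0) := by
  rw [← sub_eq_zero, S.tripleBr_sub_tripleQP hij him hjm]
  refine ⟨path_tensors_independent hjm, fun ⟨hc, hP, hQ, hL, hR⟩ => ?_⟩
  rw [hc, Finset.sum_eq_zero fun b _ => ?_, Finset.sum_eq_zero fun b _ => ?_,
    Finset.sum_eq_zero fun a _ => ?_, Finset.sum_eq_zero fun b _ => ?_]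
  · simp
  · by_cases hb : b = j
    · simp [hb, pv_self, tripleTmul]
    · rw [hR b hb, zero_smul]
  · by_cases ha : a = i
    · simp [ha, pv_self, tripleTmul]
    · rw [hL a ha, zero_smul]
  · by_cases hb : b = j
    · simp [hb, pv_self, tripleTmul]
    by_cases hb' : b = m
    · simp [hb', pv_self, tripleTmul]
    · rw [hQ b hb' hb, zero_smul]
  · by_cases hb : b = j
    · simp [hb, pv_self, tripleTmul]
    · rw [hP b hb, zero_smul]

end TripleBracket

/-- Case 3.3.b, Lemma 5.11. For a triple `(v_{ij}, v_{ji}, v_{kj})`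
with `i, j, k` pairwise distinct, the quasi-Poisson property holds iff the conditions in
the applicable case among (i), (ii), (iii) are all satisfied. Here `m` plays the role of
the index `k`. -/
theorem statement_17 {𝕜 : Type} [Field 𝕜] [CharZero 𝕜] {n : ℕ}
    (S : BracketData 𝕜 n) (i j m : Fin n)
    (hij : i ≠ j) (him : i ≠ m) (hjm : j ≠ m) :
    tripleBr S.D (pv 𝕜 n i j) (pv 𝕜 n j i) (pv 𝕜 n m j)
        = tripleQP (pe 𝕜 n) (pv 𝕜 n i j) (pv 𝕜 n j i) (pv 𝕜 n m j)
      ↔ ( (j < i →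
              ( (∀ a, j < a → a < i → S.κ i a j * (S.μ j m i + S.α j m i) = 0)
              ∧ ((2 : 𝕜)⁻¹ * (S.μ j m i + S.α j m i) - S.μ j m i * S.α j m i = (4 : 𝕜)⁻¹)
              ∧ (S.ν j m i * (S.μ i m j + (2 : 𝕜)⁻¹) = 0)
              ∧ (S.μ j m i + S.α j m i - S.ν j m i * S.ν i m j = 0) ))
        ∧ ((m < i ∧ i < j) ∨ (i < j ∧ j < m) →
              ( (∀ b, i < b → b < j → S.κ j b i * (S.μ j m i - S.μ j m b) = 0)
              ∧ (∀ b, i < b → b < j → S.κ j b i * (S.α j m i - S.α j m b) = 0)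
              ∧ (∀ b, i < b → b < j → S.κ j b i * S.ν j m b = 0)
              ∧ ((2 : 𝕜)⁻¹ * (S.μ j m i + S.α j m i) + S.μ j m i * S.α j m i
                    = -(4 : 𝕜)⁻¹)
              ∧ (S.ν j m i * (S.μ i m j - (2 : 𝕜)⁻¹) = 0)
              ∧ (S.μ j m i + S.α j m i + S.ν j m i * S.ν i m j = 0) ))
        ∧ (i < m ∧ m < j →
              ( (∀ b, i < b → b < j →
                    S.κ j b i * (S.μ j m i - S.μ j m b
                      + (2 : 𝕜)⁻¹ * (if m = b then (1 : 𝕜) else 0)) = 0)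
              ∧ (∀ b, i < b → b ≤ m →
                    S.κ j b i * (S.α j m i - S.α j m b
                      + (2 : 𝕜)⁻¹ * (if m = b then (1 : 𝕜) else 0)) = 0)
              ∧ (∀ b, m < b → b < j →
                    S.κ j b i * (S.α j m i - S.α j m b) + S.κ j b m * S.κ j m i = 0)
              ∧ (∀ b, i < b → b < j → S.κ j b i * S.ν j m b = 0)
              ∧ ((2 : 𝕜)⁻¹ * (S.μ j m i + S.α j m i) + S.μ j m i * S.α j m i
                    = -(4 : 𝕜)⁻¹)
              ∧ (S.ν j m i * (S.μ i m j - (2 : 𝕜)⁻¹) = 0)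
              ∧ (S.μ j m i + S.α j m i + S.ν j m i * S.ν i m j + S.κ j m i = 0) )) ) := by
  rw [S.tripleBr_eq_tripleQP_iff hij him hjm]
  rcases lt_or_gt_of_ne hij.symm with hlt | hlt
  · have hκ : ∀ b, S.κ j b i = 0 := fun b => S.hκ _ _ _ fun h => by omega
    have hκj : S.κ i j j = 0 := S.hκ _ _ _ fun h => by omega
    have h1 : ¬((m < i ∧ i < j) ∨ (i < j ∧ j < m)) := by omega
    have h2 : ¬(i < m ∧ m < j) := by omega
    simp only [hlt, h1, h2, if_true, hκ, zero_mul, zero_add, neg_zero, implies_true, true_and,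
      and_true, forall_const, false_imp_iff, one_mul, mul_one]
    constructor
    · rintro ⟨hc, hQ, hL⟩
      refine ⟨fun a hja hai => ?_, ?_, ?_, ?_⟩
      · have h := hL a hai.ne
        rw [if_neg hja.ne] at h
        linear_combination -h
      · have h := hL j hij.symm
        rw [if_pos rfl, hκj] at h
        linear_combination -h
      · simpa using hQ i him hij
      · linear_combination -hc
    · rintro ⟨hκi, hμα, hν, hc⟩
      refine ⟨by linear_combination -hc, fun b _ _ => ?_, fun a ha => ?_⟩
      · split_ifs
        · exact hν
        · rfl
      · split_ifs with h
        · subst h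
          rw [hκj]
          linear_combination -hμα
        · by_cases h' : j < a ∧ a < i
          · rw [hκi a h'.1 h'.2, neg_zero, add_zero]
          · rw [S.hκ _ _ _ h', zero_mul, neg_zero, add_zero]
  · have hκ : ∀ a, S.κ i a j = 0 := fun a => S.hκ _ _ _ fun h => by omega
    have hκi : S.κ j i i = 0 := S.hκ _ _ _ fun h => by omega
    have hji : ¬ j < i := hlt.not_gt
    have hL : (∀ a, a ≠ i → -(S.κ i a j * (S.μ j m i + S.α j m i)) + (if j = a then
        S.μ j m i * S.α j m i + 4⁻¹ - 2⁻¹ * -1 * (S.μ j m i + S.α j m i) else 0) = 0) ↔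
        2⁻¹ * (S.μ j m i + S.α j m i) + S.μ j m i * S.α j m i = -4⁻¹ := by
      simp only [hκ, zero_mul, neg_zero, zero_add, ite_eq_right_iff]
      refine ⟨fun h => ?_, fun h a _ _ => ?_⟩
      · linear_combination h j hij.symm rfl
      · linear_combination h
    have hQ : (∀ b, b ≠ m → b ≠ j → -(S.κ j b i * S.ν j m b) + (if i = b then
        S.ν j m i * (S.μ i m j + 2⁻¹ * -1) else 0) = 0) ↔
        (∀ b, i < b → b < j → S.κ j b i * S.ν j m b = 0) ∧
          S.ν j m i * (S.μ i m j - 2⁻¹) = 0 := by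
      refine ⟨fun h => ⟨fun b hib hbj => ?_, ?_⟩, fun ⟨h, hν⟩ b _ _ => ?_⟩
      · by_cases hbm : b = m
        · rw [hbm, S.hν_diag, mul_zero]
        · simpa [hib.ne] using h b hbm hbj.ne
      · have := h i him hij
        rw [if_pos rfl, hκi] at this
        linear_combination this
      · split_ifs with hib
        · subst hib
          rw [hκi]
          linear_combination hν
        · by_cases hb : i < b ∧ b < j
          · rw [h b hb.1 hb.2, neg_zero, add_zero]
          · rw [S.hκ _ _ _ hb, zero_mul, neg_zero, add_zero]
    have hP : (∀ b, b ≠ j →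
        S.κ j b i * (S.μ j m i - S.μ j m b + 2⁻¹ * if m = b then 1 else 0) = 0) ↔
        ∀ b, i < b → b < j →
          S.κ j b i * (S.μ j m i - S.μ j m b + 2⁻¹ * if m = b then 1 else 0) = 0 := by
      refine ⟨fun h b _ hbj => h b hbj.ne, fun h b _ => ?_⟩
      by_cases hb : i < b ∧ b < j
      · exact h b hb.1 hb.2
      · rw [S.hκ _ _ _ hb, zero_mul]
    simp only [hji, hlt, if_false, hL, hQ, hP, true_and, false_imp_iff]
    by_cases hm : i < m ∧ m < j
    · have h1 : ¬(m < i ∨ j < m) := by omega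
      have hR : (∀ b, b ≠ j →
          S.κ j b i * (S.α j m i - S.α j m b + 2⁻¹ * if m = b then 1 else 0)
            + S.κ j m i * S.κ j b m = 0) ↔
          (∀ b, i < b → b ≤ m →
            S.κ j b i * (S.α j m i - S.α j m b + 2⁻¹ * if m = b then 1 else 0) = 0) ∧
          ∀ b, m < b → b < j →
            S.κ j b i * (S.α j m i - S.α j m b) + S.κ j b m * S.κ j m i = 0 := by
        refine ⟨fun h => ⟨fun b _ hbm => ?_, fun b hmb hbj => ?_⟩, fun ⟨h, h'⟩ b hbj => ?_⟩
        · have := h b (hbm.trans_lt hm.2).ne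
          rwa [S.hκ j b m fun h => h.1.not_ge hbm, mul_zero, add_zero] at this
        · have := h b hbj.ne
          rw [if_neg hmb.ne] at this
          linear_combination this
        · rcases le_or_gt b m with hbm | hmb
          · rw [S.hκ j b m fun h => h.1.not_ge hbm, mul_zero, add_zero]
            by_cases hb : i < b
            · exact h b hb hbm
            · rw [S.hκ j b i fun h => hb h.1, zero_mul]
          · rw [if_neg hmb.ne]
            by_cases hb : b < j
            · linear_combination h' b hmb hb
            · rw [S.hκ j b i fun h => hb h.2, S.hκ j b m fun h => hb h.2, zero_mul, mul_zero,
                add_zero]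
      simp only [and_true, h1, hR, hm, true_imp_iff, false_imp_iff, true_and]
      constructor
      · rintro ⟨hc, hP, ⟨hκν, hν⟩, hL, hR, hR'⟩
        exact ⟨hP, hR, hR', hκν, hL, hν, by linear_combination hc⟩
      · rintro ⟨hP, hR, hR', hκν, hL, hν, hc⟩
        exact ⟨by linear_combination hc, hP, ⟨hκν, hν⟩, hL, hR, hR'⟩
    · have h1 : m < i ∨ j < m := by omega
      have hmb : ∀ b, i < b → b < j → m ≠ b := fun b _ _ h => by omega
      have hκm : S.κ j m i = 0 := S.hκ _ _ _ hm
      simp only [and_true, h1, hm, hκm, zero_mul, add_zero, zero_add, true_imp_iff,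
        false_imp_iff]
      constructor
      · rintro ⟨hc, hP, ⟨hκν, hν⟩, hL, hR⟩
        refine ⟨fun b hib hbj => ?_, fun b hib hbj => ?_, hκν, hL, hν, by linear_combination hc⟩
        · simpa [hmb b hib hbj] using hP b hib hbj
        · simpa [hmb b hib hbj] using hR b hbj.ne
      · rintro ⟨hP, hR, hκν, hL, hν, hc⟩
        refine ⟨by linear_combination hc, fun b hib hbj => ?_, ⟨hκν, hν⟩, hL, fun b _ => ?_⟩
        · rw [if_neg (hmb b hib hbj), mul_zero, add_zero, hP b hib hbj]
        · by_cases hb : i < b ∧ b < j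
          · rw [if_neg (hmb b hb.1 hb.2), mul_zero, add_zero, hR b hb.1 hb.2]
          · rw [S.hκ _ _ _ hb, zero_mul]

end NCQP
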